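/- (Desnanot–Jacobi–Dodgson–Sylvester identity) For an n×n matrix M over a commutative ring (n ≥ 2), det(M)·det(M_{1,n}^{1,n}) = det(M_1^1)·det(M_n^n) - det(M_1^n)·det(M_n^1), where M_i^j denotes M with row i and column j deleted, and M_{1,n}^{1,n} denotes M with rows 1,n and columns 1,n deleted. -/

import Mathlib

open Matrix in
theorem dj_block {R m k : Type*} [CommRing R] [Fintype m] [Fintype k] [DecidableEq m]
    [DecidableEq k] (N A : Matrix (m ⊕ k) (m ⊕ k) R) (d : R) (h : N * A = d • 1) :
    N * fromBlocks A.toBlocks₁₁ 0 A.toBlocks₂₁ 1 =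
      fromBlocks (d • 1) N.toBlocks₁₂ 0 N.toBlocks₂₂ := by
  obtain ⟨a, b, c, e, rfl⟩ : ∃ a b c e, N = fromBlocks a b c e :=
    ⟨_, _, _, _, (fromBlocks_toBlocks N).symm⟩
  obtain ⟨a', b', c', e', rfl⟩ : ∃ a b c e, A = fromBlocks a b c e :=
    ⟨_, _, _, _, (fromBlocks_toBlocks A).symm⟩
  rw [fromBlocks_multiply, ← fromBlocks_one, fromBlocks_smul, fromBlocks_inj] at h
  obtain ⟨h11, -, h21, -⟩ := h
  simp [fromBlocks_multiply, h11, h21]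

open Matrix in
theorem dj_aux {R : Type*} [CommRing R] (n : ℕ) (M : Matrix (Fin (n + 2)) (Fin (n + 2)) R) :
    M.det * (M.det * (M.submatrix (fun k : Fin n => Fin.castSucc (Fin.succ k))
        (fun k : Fin n => Fin.castSucc (Fin.succ k))).det) =
      M.det * ((M.submatrix (0 : Fin (n + 2)).succAbove (0 : Fin (n + 2)).succAbove).det *
          (M.submatrix (Fin.last (n + 1)).succAbove (Fin.last (n + 1)).succAbove).det -
        (M.submatrix (0 : Fin (n + 2)).succAbove (Fin.last (n + 1)).succAbove).det *
          (M.submatrix (Fin.last (n + 1)).succAbove (0 : Fin (n + 2)).succAbove).det) := by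
  let f : Fin 2 ⊕ Fin n → Fin (n + 2) :=
    Sum.elim ![0, Fin.last (n + 1)] (fun k => Fin.castSucc (Fin.succ k))
  have hf : Function.Bijective f := by
    rw [Fintype.bijective_iff_injective_and_card]
    constructor
    · rintro (a | a) (b | b) h
      · fin_cases a <;> fin_cases b <;> simp [f, Fin.ext_iff] at h ⊢
      · have := b.2
        fin_cases a <;> simp [f, Fin.ext_iff] at h
        omega
      · have := a.2
        fin_cases b <;> simp [f, Fin.ext_iff] at h
        omega
      · simpa [f, Fin.ext_iff] using h
    · simp; omega
  let e := Equiv.ofBijective f hf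
  let N := M.submatrix e e
  have hN : N.det = M.det := det_submatrix_equiv_self e M
  have hadj : N.adjugate = M.adjugate.submatrix e e := adjugate_submatrix_equiv_self e M
  have h1 : N * N.adjugate = N.det • 1 := mul_adjugate N
  have h2 : N * fromBlocks N.adjugate.toBlocks₁₁ 0 N.adjugate.toBlocks₂₁ 1 =
      fromBlocks (N.det • 1) N.toBlocks₁₂ 0 N.toBlocks₂₂ :=
    dj_block _ _ _ h1
  have h3 := congrArg det h2
  rw [det_mul, det_fromBlocks_zero₁₂, det_fromBlocks_zero₂₁, det_smul, hadj, hN] at h3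
  have hD : N.toBlocks₂₂ = M.submatrix (fun k : Fin n => Fin.castSucc (Fin.succ k))
        (fun k : Fin n => Fin.castSucc (Fin.succ k)) := by
    ext i j; rfl
  have e0 : e (Sum.inl 0) = 0 := rfl
  have e1 : e (Sum.inl 1) = Fin.last (n + 1) := rfl
  have hs : ((-1 : R) ^ (n + 1)) * (-1) ^ (n + 1) = 1 := by
    rw [← mul_pow]; simp
  have hs2 : ((-1 : R) ^ (n + 1 + (n + 1))) = 1 := by
    rw [pow_add, hs]
  rw [hD, det_fin_two] at h3
  simp only [toBlocks₁₁, of_apply, submatrix_apply, e0, e1, adjugate_fin_succ_eq_det_submatrix,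
    det_one, mul_one, Fintype.card_fin, Fin.val_zero, Fin.val_last, add_zero, zero_add, pow_zero,
    one_mul, hs2] at h3
  linear_combination (-1 : R) * h3 - M.det *
    (M.submatrix (0 : Fin (n + 2)).succAbove (Fin.last (n + 1)).succAbove).det *
          (M.submatrix (Fin.last (n + 1)).succAbove (0 : Fin (n + 2)).succAbove).det * hs

/-- Desnanot–Jacobi–Dodgson–Sylvester identity: for an `n×n` matrix `M` (`n ≥ 2`) over a
commutative ring, `det(M)·det(M_{1,n}^{1,n}) = det(M_1^1)·det(M_n^n) − det(M_1^n)·det(M_n^1)`,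
where upper/lower indices indicate deleted rows/columns. -/
theorem stmt12 {R : Type*} [CommRing R] (n : ℕ) (M : Matrix (Fin (n + 2)) (Fin (n + 2)) R) :
    M.det * (M.submatrix (fun k : Fin n => Fin.castSucc (Fin.succ k))
        (fun k : Fin n => Fin.castSucc (Fin.succ k))).det =
      (M.submatrix (0 : Fin (n + 2)).succAbove (0 : Fin (n + 2)).succAbove).det *
          (M.submatrix (Fin.last (n + 1)).succAbove (Fin.last (n + 1)).succAbove).det -
        (M.submatrix (0 : Fin (n + 2)).succAbove (Fin.last (n + 1)).succAbove).det *
          (M.submatrix (Fin.last (n + 1)).succAbove (0 : Fin (n + 2)).succAbove).det := by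
  have key := mul_left_cancel₀ (Matrix.det_mvPolynomialX_ne_zero (Fin (n + 2)) ℤ)
    (dj_aux n (Matrix.mvPolynomialX (Fin (n + 2)) (Fin (n + 2)) ℤ))
  let φ := MvPolynomial.eval₂Hom (Int.castRingHom R) (fun p : Fin (n + 2) × Fin (n + 2) => M p.1 p.2)
  have hM : (Matrix.mvPolynomialX (Fin (n + 2)) (Fin (n + 2)) ℤ).map φ = M :=
    Matrix.mvPolynomialX_map_eval₂ (Int.castRingHom R) M
  have h := congrArg φ key
  simp only [map_mul, map_sub, RingHom.map_det, RingHom.mapMatrix_apply, ← Matrix.submatrix_map,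
    hM] at h
  exact h
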